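/- arXiv:1104.2099 — 2 statements merged into one kernel-verified Lean document; each statement's English description precedes it below -/
import Mathlib

section
/- Let s ≥ 1 and let G be a graph on n = s·m vertices. If the minimum degree of G satisfies δ(G) ≥ (s−1)·m, then G can be tiled with K_s (the complete graph on s vertices). -/
open scoped Classical
open Finset

namespace PaperTiling

variable {V : Type*} [Fintype V] [DecidableEq V]

/-- The number of neighbours of `v` inside the set `S`. -/
noncomputable def degS (G : SimpleGraph V) (v : V) (S : Finset V) : ℕ :=
  (S.filter fun w => G.Adj v w).card

/-- The number of edges of `G` with one end in `A` and the other in `B`. -/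
noncomputable def eAB (G : SimpleGraph V) (A B : Finset V) : ℕ :=
  ∑ v ∈ A, degS G v B

/-- The edge density `d(A,B) = e(A,B)/(|A||B|)`. -/
noncomputable def dens (G : SimpleGraph V) (A B : Finset V) : ℝ :=
  (eAB G A B : ℝ) / ((A.card : ℝ) * (B.card : ℝ))

/-- `G` is a bipartite graph with parts `A` and `B`. -/
def IsBipartition (G : SimpleGraph V) (A B : Finset V) : Prop :=
  Disjoint A B ∧ A ∪ B = Finset.univ ∧
    ∀ u v : V, G.Adj u v → (u ∈ A ∧ v ∈ B) ∨ (u ∈ B ∧ v ∈ A)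

/-- `(S, T)` spans a copy of the complete bipartite graph `K_{s,t}` in `G`,
with `S` the side of size `s` and `T` the side of size `t`. -/
def IsKst (G : SimpleGraph V) (s t : ℕ) (S T : Finset V) : Prop :=
  Disjoint S T ∧ S.card = s ∧ T.card = t ∧ ∀ u ∈ S, ∀ v ∈ T, G.Adj u v

/-- `𝒯` is a perfect `K_{s,t}`-tiling of `G`: a collection of pairwise
vertex-disjoint copies of `K_{s,t}` covering all vertices. -/
def IsKstTiling (G : SimpleGraph V) (s t : ℕ)
    (𝒯 : Finset (Finset V × Finset V)) : Prop :=
  (∀ P ∈ 𝒯, IsKst G s t P.1 P.2) ∧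
  (𝒯 : Set (Finset V × Finset V)).PairwiseDisjoint (fun P => P.1 ∪ P.2) ∧
  𝒯.sup (fun P => P.1 ∪ P.2) = Finset.univ

/-- `G` can be tiled with `K_{s,t}`. -/
def KstTileable (G : SimpleGraph V) (s t : ℕ) : Prop :=
  ∃ 𝒯 : Finset (Finset V × Finset V), IsKstTiling G s t 𝒯

/-- `G` can be tiled with the complete graph `K_s`. -/
def CliqueTileable (G : SimpleGraph V) (s : ℕ) : Prop :=
  ∃ 𝒞 : Finset (Finset V),
    (∀ S ∈ 𝒞, S.card = s ∧ G.IsClique (S : Set V)) ∧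
    (𝒞 : Set (Finset V)).PairwiseDisjoint id ∧
    𝒞.sup id = Finset.univ

/-- The minimum degree of `G` equals the real number `c`. -/
def MinDegreeIs (G : SimpleGraph V) (c : ℝ) : Prop :=
  (∀ v : V, c ≤ (degS G v Finset.univ : ℝ)) ∧
  ∃ v : V, (degS G v Finset.univ : ℝ) = c

/-- `(c, L)` is an `h`-star with centre `c ∈ A` and `h` leaves `L ⊆ B`. -/
def IsStar (G : SimpleGraph V) (h : ℕ) (A B : Finset V) (c : V) (L : Finset V) : Prop :=
  c ∈ A ∧ L ⊆ B ∧ L.card = h ∧ ∀ v ∈ L, G.Adj c v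

/-- `𝒮` is a family of pairwise vertex-disjoint `h`-stars from `A` to `B`. -/
def StarFamily (G : SimpleGraph V) (h : ℕ) (A B : Finset V)
    (𝒮 : Finset (V × Finset V)) : Prop :=
  (∀ S ∈ 𝒮, IsStar G h A B S.1 S.2) ∧
  (𝒮 : Set (V × Finset V)).PairwiseDisjoint (fun S => insert S.1 S.2)

/-- The structure hypotheses (H) for the extremal construction of the paper:
`1 ≤ s < t`, `t ≥ 2s+1`, `k ≥ 1`, `G` is bipartite with parts
`U₀ ∪ U₁ ∪ U₂` and `V₀ ∪ V₁ ∪ V₂`, with the prescribed part sizes,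
complete pairs `(U₁,V₁)`, `(U₂,V₂)`, `(U₀, V₁∪V₂)`, `(V₀, U₁∪U₂)`,
no edges between `U₀` and `V₀`, and sparse `K_{2,2}`-free diagonal pairs. -/
structure StructH (G : SimpleGraph V) (s t k : ℕ)
    (U0 U1 U2 V0 V1 V2 : Finset V) : Prop where
  hs : 1 ≤ s
  hst : s < t
  ht : 2 * s + 1 ≤ t
  hk : 1 ≤ k
  bip : IsBipartition G (U0 ∪ U1 ∪ U2) (V0 ∪ V1 ∪ V2)
  hU01 : Disjoint U0 U1
  hU02 : Disjoint U0 U2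
  hU12 : Disjoint U1 U2
  hV01 : Disjoint V0 V1
  hV02 : Disjoint V0 V2
  hV12 : Disjoint V1 V2
  cardU0 : U0.card = s - 1
  cardV0 : V0.card = s - 1
  cardU1 : U1.card = k * (s + t) + (t + 1) / 2
  cardV2 : V2.card = k * (s + t) + (t + 1) / 2
  cardV1 : V1.card = k * (s + t) + (t + 2) / 2
  cardU2 : U2.card = k * (s + t) + (t + 2) / 2
  compU1V1 : ∀ u ∈ U1, ∀ v ∈ V1, G.Adj u v
  compU2V2 : ∀ u ∈ U2, ∀ v ∈ V2, G.Adj u v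
  compU0 : ∀ u ∈ U0, ∀ v ∈ V1 ∪ V2, G.Adj u v
  compV0 : ∀ v ∈ V0, ∀ u ∈ U1 ∪ U2, G.Adj u v
  emptyU0V0 : ∀ u ∈ U0, ∀ v ∈ V0, ¬ G.Adj u v
  K22freeU1V2 : ∀ S T : Finset V, S ⊆ U1 → T ⊆ V2 → ¬ IsKst G 2 2 S T
  K22freeU2V1 : ∀ S T : Finset V, S ⊆ U2 → T ⊆ V1 → ¬ IsKst G 2 2 S T
  degU1 : ∀ u ∈ U1, degS G u V2 ≤ s - 1
  degU2 : ∀ u ∈ U2, degS G u V1 ≤ s - 1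
  degV1 : ∀ v ∈ V1, degS G v U2 ≤ s - 1
  degV2 : ∀ v ∈ V2, degS G v U1 ≤ s - 1

/-- The vertex set `W` of a copy of `K_{s,t}` is crossing. -/
def Crossing (U1 V1 U2 V2 W : Finset V) : Prop :=
  (W ∩ (U1 ∪ V1)).Nonempty ∧ (W ∩ (U2 ∪ V2)).Nonempty

/-- `W` is crossing from the set `A`, where `AD = A^D` is the diagonal set of `A`
and `AM = A^M` is the opposite middle set of `A`. -/
def CrossingFrom (W A AD AM : Finset V) : Prop :=
  (W ∩ A).card = 1 ∧
    (2 ≤ (W ∩ AD).card ∨ ((W ∩ AD).card = 1 ∧ (W ∩ AM).Nonempty))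

/-- `W` is of Type 1 (crossing from `A`), where `AD = A^D`, `AN = A^N`,
`ANM = (A^N)^M`. -/
def Type1From (s t : ℕ) (W AD AN ANM : Finset V) : Prop :=
  ∃ p : ℕ, 2 ≤ p ∧ p ≤ s - 1 ∧ (W ∩ ANM).card = s - 1 ∧
    (W ∩ AN).card = t - p ∧ (W ∩ AD).card = p

/-- `W` is of Type 2 (crossing from `A`), where `AD = A^D`, `AM = A^M`,
`AND = (A^N)^D`. -/
def Type2From (s t : ℕ) (W AD AM AND : Finset V) : Prop :=
  ∃ p : ℕ, 1 ≤ p ∧ p ≤ s - 1 ∧ (W ∩ AND).card = t - 1 ∧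
    (W ∩ AM).card = s - p ∧ (W ∩ AD).card = p

/-- `f` is a proper colouring of `G`. -/
def Proper {α κ : Type*} (G : SimpleGraph α) (f : α → κ) : Prop :=
  ∀ ⦃v w⦄, G.Adj v w → f v ≠ f w

/-- The colour class of `c`. -/
noncomputable def fiber {α κ : Type*} [Fintype α] (f : α → κ) (c : κ) : Finset α :=
  univ.filter fun v => f v = c

/-- Every colour class has size `s`, except that `a` lacks a vertex and `b` has an extra one.
For `a = b` all classes have size `s`. -/
def NearlyEquitable {α κ : Type*} [Fintype α] (s : ℕ) (f : α → κ) (a b : κ) : Prop :=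
  ∀ c, (fiber f c).card + (if c = a then 1 else 0) = s + (if c = b then 1 else 0)

/-- `v` has no neighbour of colour `c`. -/
def Movable {α κ : Type*} (G : SimpleGraph α) (f : α → κ) (v : α) (c : κ) : Prop :=
  ∀ ⦃w⦄, G.Adj v w → f w ≠ c

/-- Some vertex of colour `c` can be moved to colour `d`. -/
def MoveEdge {α κ : Type*} (G : SimpleGraph α) (f : α → κ) (c d : κ) : Prop :=
  ∃ v, f v = c ∧ Movable G f v d

/-- `a` is reachable from `x` by a path of `R` none of whose edges meets `u`. -/
def ReachAvoiding {κ : Type*} (R : κ → κ → Prop) (u a x : κ) : Prop :=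
  Relation.ReflTransGen (fun p q => R p q ∧ p ≠ u ∧ q ≠ u) x a

/-- The points from which `a` can be reached. -/
noncomputable def accessible {κ : Type*} [Fintype κ] (R : κ → κ → Prop) (a : κ) : Finset κ :=
  univ.filter fun c => Relation.ReflTransGen R c a

/-- The points other than `u` from which `a` can be reached, but only through `u`. -/
noncomputable def cutOff {κ : Type*} [Fintype κ] (R : κ → κ → Prop) (a u : κ) : Finset κ :=
  univ.filter fun x => Relation.ReflTransGen R x a ∧ x ≠ u ∧ ¬ ReachAvoiding R u a x

section Reachability

variable {κ : Type*} {R : κ → κ → Prop} {a : κ}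

lemma mem_accessible [Fintype κ] {c : κ} :
    c ∈ accessible R a ↔ Relation.ReflTransGen R c a := by
  simp [accessible]

lemma mem_cutOff [Fintype κ] {u x : κ} : x ∈ cutOff R a u ↔
    Relation.ReflTransGen R x a ∧ x ≠ u ∧ ¬ ReachAvoiding R u a x := by
  simp [cutOff]

/-- There is a rank function that decreases along suitable paths to `a`. -/
lemma exists_rank (R : κ → κ → Prop) (a : κ) : ∃ d : κ → ℕ, ∀ x,
    Relation.ReflTransGen R x a → x ≠ a →
      ∃ y, R x y ∧ Relation.ReflTransGen R y a ∧ d y < d x := by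
  let P : ℕ → κ → Prop := fun n => Nat.rec (fun x => x = a) (fun _ p x => ∃ y, R x y ∧ p y) n
  have hP : ∀ x, Relation.ReflTransGen R x a → ∃ n, P n x := by
    intro x hx
    induction hx using Relation.ReflTransGen.head_induction_on with
    | refl => exact ⟨0, rfl⟩
    | head h _ ih =>
      obtain ⟨n, hn⟩ := ih
      exact ⟨n + 1, _, h, hn⟩
  have hR : ∀ n x, P n x → Relation.ReflTransGen R x a := by
    intro n
    induction n with
    | zero =>
      intro x (hx : x = a)
      rw [hx]
    | succ n ih => rintro x ⟨y, hxy, hy⟩; exact .head hxy (ih y hy)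
  refine ⟨fun x => sInf {n | P n x}, fun x hx hxa => ?_⟩
  have hmem : P (sInf {n | P n x}) x := Nat.sInf_mem (hP x hx)
  rcases hn : sInf {n | P n x} with _ | n
  · rw [hn] at hmem
    exact absurd hmem hxa
  · rw [hn] at hmem
    obtain ⟨y, hxy, hy⟩ := hmem
    refine ⟨y, hxy, hR n y hy, ?_⟩
    have : sInf {n | P n y} ≤ n := Nat.sInf_le hy
    change sInf {n | P n y} < sInf {n | P n x}
    omega

lemma ReachAvoiding.reach {u x : κ} (h : ReachAvoiding R u a x) : Relation.ReflTransGen R x a :=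
  Relation.ReflTransGen.mono (fun _ _ h => h.1) _ _ h

lemma exists_step_avoiding {u : κ} (hu : Relation.ReflTransGen R u a) (hua : u ≠ a) :
    ∃ c, R u c ∧ c ≠ u ∧ ReachAvoiding R u a c := by
  obtain ⟨d, hd⟩ := exists_rank R a
  have key : ∀ n y, d y = n → d y < d u → Relation.ReflTransGen R y a →
      ReachAvoiding R u a y := by
    intro n
    induction n using Nat.strong_induction_on with
    | _ n ih =>
      intro y hyn hyu hy
      by_cases hya : y = a
      · subst hya; exact .refl
      · obtain ⟨z, hyz, hz, hzy⟩ := hd y hy hya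
        refine .head ⟨hyz, ?_, ?_⟩ (ih (d z) (hyn ▸ hzy) z rfl (by omega) hz)
        · rintro rfl; omega
        · rintro rfl; omega
  obtain ⟨c, huc, hc, hcu⟩ := hd u hu hua
  refine ⟨c, huc, ?_, key _ c rfl hcu hc⟩
  rintro rfl
  omega

/-- A path avoiding `u` also avoids every point that is cut off by `u`. -/
lemma ReachAvoiding.avoiding_of_mem_cutOff [Fintype κ] {u x v : κ} (hx : x ∈ cutOff R a u)
    (hv : ReachAvoiding R u a v) : ReachAvoiding R x a v := by
  have hx' := (mem_cutOff.1 hx).2.2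
  induction hv using Relation.ReflTransGen.head_induction_on with
  | refl => exact .refl
  | head h hr ih =>
    refine .head ⟨h.1, ?_, ?_⟩ ih
    · rintro rfl; exact hx' (.head h hr)
    · rintro rfl; exact hx' hr

lemma target_not_mem_cutOff [Fintype κ] {u : κ} : a ∉ cutOff R a u :=
  fun h => (mem_cutOff.1 h).2.2 .refl

lemma cutOff_target [Fintype κ] : cutOff R a a = (accessible R a).erase a := by
  ext x
  simp only [mem_cutOff, mem_erase, mem_accessible]
  refine ⟨fun h => ⟨h.2.1, h.1⟩, fun h => ⟨h.2, h.1, fun hx => ?_⟩⟩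
  rcases Relation.ReflTransGen.cases_tail hx with hx | ⟨_, _, hx⟩
  · exact h.1 hx.symm
  · exact hx.2.2 rfl

/-- If some point other than `a` is accessible, some `u` cuts off a nonempty set of points none of
which cuts off anything. -/
lemma exists_minimal_cutOff [Fintype κ] (h : ((accessible R a).erase a).Nonempty) :
    ∃ u, (cutOff R a u).Nonempty ∧ ∀ x ∈ cutOff R a u, cutOff R a x = ∅ := by
  have hne : (univ.filter fun u => (cutOff R a u).Nonempty).Nonempty :=
    ⟨a, by simpa [cutOff_target] using h⟩
  obtain ⟨u, hu, hmin⟩ := exists_min_image _ (fun u => (cutOff R a u).card) hne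
  simp only [mem_filter, mem_univ, true_and] at hu hmin
  refine ⟨u, hu, fun x hx => ?_⟩
  by_contra hxne
  refine absurd (hmin x (nonempty_iff_ne_empty.2 hxne)) (not_le.2 (card_lt_card ?_))
  refine ssubset_of_subset_of_ne (fun v hv => ?_) fun heq => ?_
  · obtain ⟨hva, hvx, hv⟩ := mem_cutOff.1 hv
    refine mem_cutOff.2 ⟨hva, ?_, fun hvu => hv (hvu.avoiding_of_mem_cutOff hx)⟩
    rintro rfl
    by_cases hv' : v = a
    · subst hv'; exact hv .refl
    · obtain ⟨c, hvc, hcv, hc⟩ := exists_step_avoiding hva hv'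
      have hcx : c ≠ x := by
        rintro rfl
        exact (mem_cutOff.1 hx).2.2 hc
      exact hv (.head ⟨hvc, hvx, hcx⟩ (hc.avoiding_of_mem_cutOff hx))
  · rw [← heq] at hx
    exact (mem_cutOff.1 hx).2.1 rfl

end Reachability

section Recolouring

variable {α κ : Type*} {G : SimpleGraph α} {f : α → κ} {s : ℕ} {a b : κ}

lemma mem_fiber [Fintype α] {c : κ} {v : α} : v ∈ fiber f c ↔ f v = c := by
  simp [fiber]

lemma Proper.update (hf : Proper G f) {v : α} {c : κ} (hv : Movable G f v c) :
    Proper G (Function.update f v c) := by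
  intro x y hxy
  by_cases hx : x = v
  · subst hx
    rw [Function.update_self, Function.update_of_ne hxy.ne']
    exact (hv hxy).symm
  · rw [Function.update_of_ne hx]
    by_cases hy : y = v
    · subst hy
      rw [Function.update_self]
      exact hv hxy.symm
    · rw [Function.update_of_ne hy]
      exact hf hxy

lemma card_fiber_update [Fintype α] (f : α → κ) (v : α) (c d : κ) :
    (fiber (Function.update f v c) d).card + (if d = f v then 1 else 0) =
      (fiber f d).card + (if d = c then 1 else 0) := by
  have h1 : ∀ g : α → κ, (fiber g d).card =
      ((fiber g d).erase v).card + (if d = g v then 1 else 0) := by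
    intro g
    split_ifs with h
    · rw [card_erase_add_one (mem_fiber.2 h.symm)]
    · rw [erase_eq_of_notMem (fun h' => h (mem_fiber.1 h').symm), add_zero]
  have h2 : (fiber (Function.update f v c) d).erase v = (fiber f d).erase v := by
    ext w
    simp only [mem_erase, mem_fiber, and_congr_right_iff]
    intro hw
    rw [Function.update_of_ne hw]
  rw [h1 f, h1 (Function.update f v c), h2, Function.update_self]
  omega

/-- If the large class `b` reaches the small class `a` along edges decreasing a rank, then moving
one vertex along each edge of the path makes the colouring equitable. -/
lemma exists_equitable_of_rank [Fintype α] (T : Set κ) (d : κ → ℕ) (hf : Proper G f)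
    (hsize : NearlyEquitable s f a b) (hb : b ∈ T)
    (hd : ∀ x ∈ T, d x ≤ d b → x ≠ a → ∃ y ∈ T, d y < d x ∧ MoveEdge G f x y) :
    ∃ g : α → κ, Proper G g ∧ ∀ c, (fiber g c).card = s := by
  induction hn : d b using Nat.strong_induction_on generalizing f b with
  | _ n ih =>
    subst hn
    by_cases hba : b = a
    · subst hba
      exact ⟨f, hf, fun c => Nat.add_right_cancel (hsize c)⟩
    obtain ⟨c, hc, hcb, v, hv, hvc⟩ := hd b hb le_rfl hba
    refine ih (d c) hcb (hf.update hvc) (b := c) (fun e => ?_) hc (fun x hx hxc hxa => ?_) rfl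
    · have h1 := card_fiber_update f v c e
      have h2 := hsize e
      rw [hv] at h1
      omega
    · obtain ⟨y, hy, hyx, w, hw, hwy⟩ := hd x hx (by omega) hxa
      have hwv : w ≠ v := by
        rintro rfl
        rw [hv] at hw
        subst hw
        omega
      refine ⟨y, hy, hyx, w, by rwa [Function.update_of_ne hwv], fun u hu => ?_⟩
      by_cases huv : u = v
      · subst huv
        rw [Function.update_self]
        rintro rfl
        omega
      · rw [Function.update_of_ne huv]
        exact hwy hu

lemma exists_equitable_of_accessible [Fintype α] (hf : Proper G f)
    (hsize : NearlyEquitable s f a b) (hb : Relation.ReflTransGen (MoveEdge G f) b a) :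
    ∃ g : α → κ, Proper G g ∧ ∀ c, (fiber g c).card = s := by
  obtain ⟨d, hd⟩ := exists_rank (MoveEdge G f) a
  refine exists_equitable_of_rank {x | Relation.ReflTransGen (MoveEdge G f) x a} d hf hsize hb
    fun x hx _ hxa => ?_
  obtain ⟨y, hxy, hy, hlt⟩ := hd x hx hxa
  exact ⟨y, hy, hlt, hxy⟩

/-- `z` is the only neighbour of `y` in the colour class of `z`. -/
def Solo (G : SimpleGraph α) (f : α → κ) (z y : α) : Prop :=
  G.Adj y z ∧ ∀ ⦃w⦄, G.Adj y w → f w = f z → w = z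

/-- Swap the vertex `z` for its solo neighbour `y`, move `z` to `c`, and recolour the remaining
vertices with colours outside `A` by `g`. -/
lemma exists_swap [Fintype α] {A : Finset κ} {g : α → κ} {y z : α} {c : κ} (hf : Proper G f)
    (hsize : NearlyEquitable s f a b) (haA : a ∈ A) (hbA : b ∉ A)
    (hzA : f z ∈ A) (hyA : f y ∉ A) (hzy : Solo G f z y)
    (hgA : ∀ v, f v ∉ A → v ≠ y → g v ∉ A)
    (hg : ∀ v w, f v ∉ A → v ≠ y → f w ∉ A → w ≠ y → G.Adj v w → g v ≠ g w)
    (hgs : ∀ d ∉ A, (univ.filter fun v => f v ∉ A ∧ v ≠ y ∧ g v = d).card = s)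
    (hcz : c ≠ f z) (hcg : ∀ w, f w ∉ A → w ≠ y → G.Adj z w → g w ≠ c)
    (hcf : ∀ w, f w ∈ A → G.Adj z w → f w ≠ c) :
    ∃ h : α → κ, Proper G h ∧ NearlyEquitable s h a c ∧ h z = c ∧ h y = f z ∧
      (∀ v, f v ∉ A → v ≠ y → h v ∉ A) ∧ ∀ v, f v ∈ A → v ≠ z → h v = f v := by
  have hyz : z ≠ y := hzy.1.ne'
  let f₀ : α → κ := fun v => if f v ∈ A then f v else if v = y then f z else g v
  have f₀A : ∀ v, f v ∈ A → f₀ v = f v := fun v hv => if_pos hv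
  have f₀y : f₀ y = f z := by simp [f₀, hyA]
  have f₀B : ∀ v, f v ∉ A → v ≠ y → f₀ v = g v := fun v hv hvy => by simp [f₀, hv, hvy]
  have hproper : ∀ v w, v ≠ z → w ≠ z → G.Adj v w → f₀ v ≠ f₀ w := by
    have hy : ∀ w, w ≠ z → G.Adj y w → f₀ w ≠ f z := by
      intro w hw hyw
      by_cases hwA : f w ∈ A
      · rw [f₀A w hwA]
        exact fun h => hw (hzy.2 hyw h)
      · rw [f₀B w hwA hyw.ne']
        exact fun h => hgA w hwA hyw.ne' (h ▸ hzA)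
    intro v w hv hw hvw
    by_cases hvy : v = y
    · subst hvy; rw [f₀y]; exact (hy w hw hvw).symm
    by_cases hwy : w = y
    · subst hwy; rw [f₀y]; exact hy v hv hvw.symm
    by_cases hvA : f v ∈ A <;> by_cases hwA : f w ∈ A
    · rw [f₀A v hvA, f₀A w hwA]; exact hf hvw
    · rw [f₀A v hvA, f₀B w hwA hwy]
      exact fun h => hgA w hwA hwy (h ▸ hvA)
    · rw [f₀B v hvA hvy, f₀A w hwA]
      exact fun h => hgA v hvA hvy (h ▸ hwA)
    · rw [f₀B v hvA hvy, f₀B w hwA hwy]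
      exact hg v w hvA hvy hwA hwy hvw
  have hz : ∀ w, G.Adj z w → f₀ w ≠ c := by
    intro w hzw
    by_cases hwA : f w ∈ A
    · rw [f₀A w hwA]; exact hcf w hwA hzw
    by_cases hwy : w = y
    · subst hwy; rw [f₀y]; exact hcz.symm
    · rw [f₀B w hwA hwy]; exact hcg w hwA hwy hzw
  have hsize₀ : NearlyEquitable s f₀ a (f z) := by
    intro d
    by_cases hdA : d ∈ A
    · have hdb : d ≠ b := fun h => hbA (h ▸ hdA)
      have hd := hsize d
      rw [if_neg hdb, add_zero] at hd
      have hmem : ∀ v, f₀ v = d ↔ f v = d ∨ v = y ∧ d = f z := by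
        intro v
        by_cases hvA : f v ∈ A
        · have : v ≠ y := fun h => hyA (h ▸ hvA)
          simp [f₀A v hvA, this]
        · have h1 : f v ≠ d := fun h => hvA (h ▸ hdA)
          by_cases hvy : v = y
          · subst hvy
            simp [f₀y, h1, eq_comm]
          · have h2 : g v ≠ d := fun h => hgA v hvA hvy (h ▸ hdA)
            simp [f₀B v hvA hvy, h1, h2, hvy]
      have hfib : (fiber f₀ d).card = (fiber f d).card + (if d = f z then 1 else 0) := by
        by_cases hdz : d = f z
        · have : fiber f₀ d = insert y (fiber f d) := by
            ext v
            simp only [mem_fiber, mem_insert, hmem]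
            tauto
          rw [this, if_pos hdz,
            card_insert_of_notMem (fun h => hyA (by rwa [mem_fiber.1 h]))]
        · have : fiber f₀ d = fiber f d := by
            ext v
            simp only [mem_fiber, hmem, hdz, and_false, or_false]
          rw [this, if_neg hdz, add_zero]
      omega
    · have hda : d ≠ a := fun h => hdA (h ▸ haA)
      have hdz : d ≠ f z := fun h => hdA (h ▸ hzA)
      rw [if_neg hda, if_neg hdz, ← hgs d hdA]
      congr 1
      congr 1
      ext v
      simp only [mem_fiber, mem_filter, mem_univ, true_and]
      by_cases hvA : f v ∈ A
      · have : f v ≠ d := fun h => hdA (h ▸ hvA)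
        simp [f₀A v hvA, hvA, this]
      · by_cases hvy : v = y
        · subst hvy
          simp [f₀y, hdz.symm]
        · simp [f₀B v hvA hvy, hvA, hvy]
  refine ⟨Function.update f₀ z c, ?_, fun d => ?_, Function.update_self .., ?_, ?_, ?_⟩
  · intro v w hvw
    by_cases hv : v = z
    · subst hv
      rw [Function.update_self, Function.update_of_ne hvw.ne']
      exact (hz w hvw).symm
    by_cases hw : w = z
    · subst hw
      rw [Function.update_self, Function.update_of_ne hv]
      exact hz v hvw.symm
    · rw [Function.update_of_ne hv, Function.update_of_ne hw]
      exact hproper v w hv hw hvw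
  · have h1 := card_fiber_update f₀ z c d
    have h2 := hsize₀ d
    rw [f₀A z hzA] at h1
    omega
  · rw [Function.update_of_ne hyz.symm, f₀y]
  · intro v hv hvy
    have hvz : v ≠ z := fun h => hv (h ▸ hzA)
    rw [Function.update_of_ne hvz, f₀B v hv hvy]
    exact hgA v hv hvy
  · intro v hv hvz
    rw [Function.update_of_ne hvz, f₀A v hv]

end Recolouring

section Counting

variable {α κ : Type*} [Fintype α] {G : SimpleGraph α} {f : α → κ} {s : ℕ} {A T : Finset κ}

/-- The number of neighbours of `v` whose colour is not in `A`. -/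
noncomputable def outDeg (G : SimpleGraph α) (f : α → κ) (A : Finset κ) (v : α) : ℕ :=
  (univ.filter fun w => G.Adj v w ∧ f w ∉ A).card

/-- The number of neighbours of `v` of colour `c`. -/
noncomputable def colDeg (G : SimpleGraph α) (f : α → κ) (v : α) (c : κ) : ℕ :=
  (univ.filter fun w => G.Adj v w ∧ f w = c).card

lemma card_filter_mem (f : α → κ) (P : Finset κ) :
    (univ.filter fun v => f v ∈ P).card = ∑ c ∈ P, (fiber f c).card := by
  have hP : Set.MapsTo f (univ.filter fun v => f v ∈ P : Finset α) P :=
    fun v hv => by simpa using hv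
  rw [card_eq_sum_card_fiberwise hP]
  refine sum_congr rfl fun c hc => ?_
  rw [filter_filter, fiber]
  congr 1
  ext v
  simp only [mem_filter, mem_univ, true_and]
  exact ⟨fun h => h.2, fun h => ⟨h ▸ hc, h⟩⟩

lemma one_le_colDeg {v : α} {c : κ} (h : ¬ Movable G f v c) : 1 ≤ colDeg G f v c := by
  simp only [Movable, not_forall, not_not] at h
  obtain ⟨w, hw, hc⟩ := h
  exact card_pos.2 ⟨w, by simp [hw, hc]⟩

lemma outDeg_add_sum_colDeg (v : α) :
    outDeg G f A v + ∑ c ∈ A, colDeg G f v c = (univ.filter fun w => G.Adj v w).card := by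
  have h1 : ∑ c ∈ A, colDeg G f v c = (univ.filter fun w => G.Adj v w ∧ f w ∈ A).card := by
    rw [card_eq_sum_card_fiberwise (f := f) (t := A) 
      (fun w hw => (mem_filter.1 hw).2.2)]
    refine sum_congr rfl fun c hc => ?_
    rw [filter_filter, colDeg]
    congr 1
    ext w
    simp only [mem_filter, mem_univ, true_and]
    constructor
    · rintro ⟨h1, rfl⟩; exact ⟨⟨h1, hc⟩, rfl⟩
    · rintro ⟨⟨h1, -⟩, h2⟩; exact ⟨h1, h2⟩
  rw [h1, ← card_filter_add_card_filter_not (s := univ.filter fun w => G.Adj v w)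
    (fun w => f w ∈ A), filter_filter, filter_filter, outDeg, add_comm]

lemma outDeg_add_card_le {P : Finset κ} {v : α} (hP : P ⊆ A)
    (h : ∀ c ∈ P, ¬ Movable G f v c) :
    outDeg G f A v + P.card ≤ (univ.filter fun w => G.Adj v w).card := by
  rw [← outDeg_add_sum_colDeg (A := A) (f := f)]
  gcongr
  calc P.card = ∑ c ∈ P, 1 := by simp
    _ ≤ ∑ c ∈ P, colDeg G f v c := sum_le_sum fun c hc => one_le_colDeg (h c hc)
    _ ≤ ∑ c ∈ A, colDeg G f v c := sum_le_sum_of_subset hP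

lemma outDeg_eq_card_filter (x : α) :
    outDeg G f A x = ((univ.filter fun v => f v ∉ A).filter fun y => G.Adj y x).card := by
  rw [outDeg, filter_filter]
  congr 1
  ext y
  simp [G.adj_comm x y, and_comm]

variable [Fintype κ]

lemma card_compl_lt_of_solo_not_movable {u W : κ}
    (hdeg : ∀ v, (univ.filter fun w => G.Adj v w).card < Fintype.card κ)
    (hTA : T ⊆ A) (hW : W ∈ T) (hWs : (fiber f W).card = s)
    (hA : ∀ v, f v ∉ A → ∀ c ∈ A, ¬ Movable G f v c)
    (hT : ∀ v, f v ∈ T → ∀ c ∈ A, c ∉ T → c ≠ u → ¬ Movable G f v c)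
    (hB : (univ.filter fun v => f v ∉ A).card = (Aᶜ).card * s + 1)
    (hz : ∀ z y, f z ∈ T → f y ∉ A → Solo G f z y → ∀ c ∈ A, c ≠ f z → ¬ Movable G f z c) :
    (Aᶜ).card < T.card := by
  have hk := card_add_card_compl A
  set q := (Aᶜ).card
  set B := univ.filter fun v => f v ∉ A with hBdef
  let S := (fiber f W).filter fun z => ∃ y, f y ∉ A ∧ Solo G f z y
  let D := (fiber f W).filter fun z => ¬ ∃ y, f y ∉ A ∧ Solo G f z y
  have hSD : S.card + D.card = s := by
    rw [← hWs]
    exact card_filter_add_card_filter_not _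
  have hS : ∀ z ∈ S, outDeg G f A z ≤ q := by
    intro z hzS
    obtain ⟨hzW, y, hy, hzy⟩ := mem_filter.1 hzS
    rw [mem_fiber] at hzW
    have h1 := outDeg_add_card_le (erase_subset (f z) A) (v := z) (f := f) (G := G) (fun c hc =>
      hz z y (hzW ▸ hW) hy hzy c (mem_of_mem_erase hc) (ne_of_mem_erase hc))
    rw [card_erase_of_mem (hTA (hzW ▸ hW))] at h1
    have h2 := hdeg z
    omega
  have hD : ∀ z ∈ D, outDeg G f A z ≤ T.card + q := by
    intro z hzD
    have hzW := mem_fiber.1 (mem_filter.1 hzD).1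
    have h1 := outDeg_add_card_le (A := A) (P := (A \ T).erase u) (v := z) (f := f) (G := G)
      ((erase_subset _ _).trans sdiff_subset) (fun c hc => by
        simp only [mem_erase, mem_sdiff] at hc
        exact hT z (hzW ▸ hW) c hc.2.1 hc.2.2 hc.1)
    have h2 := pred_card_le_card_erase (s := A \ T) (a := u)
    rw [card_sdiff_of_subset hTA] at h2
    have h3 := hdeg z
    have h4 := card_le_card hTA
    omega
  have hlow : ∀ y ∈ B, 2 ≤ 2 * (S.filter fun z => G.Adj y z).card +
      (D.filter fun z => G.Adj y z).card := by
    intro y hy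
    have hyA : f y ∉ A := by simpa [hBdef] using hy
    by_cases hSy : (S.filter fun z => G.Adj y z).Nonempty
    · have := card_pos.2 hSy
      omega
    rw [not_nonempty_iff_eq_empty] at hSy
    have hm := hA y hyA W (hTA hW)
    simp only [Movable, not_forall, not_not] at hm
    obtain ⟨w, hyw, hwW⟩ := hm
    have hSol : ¬ Solo G f w y := fun hwy => by
      have : w ∈ S.filter fun z => G.Adj y z :=
        mem_filter.2 ⟨mem_filter.2 ⟨mem_fiber.2 hwW, y, hyA, hwy⟩, hyw⟩
      simp [hSy] at this
    simp only [Solo, hyw, true_and, not_forall] at hSol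
    obtain ⟨x, hyx, hxw, hne⟩ := hSol
    have hmem : ∀ v, G.Adj y v → f v = W → v ∈ D.filter fun z => G.Adj y z := by
      intro v hyv hv
      refine mem_filter.2 ⟨mem_filter.2 ⟨mem_fiber.2 hv, fun hex => ?_⟩, hyv⟩
      have : v ∈ S.filter fun z => G.Adj y z :=
        mem_filter.2 ⟨mem_filter.2 ⟨mem_fiber.2 hv, hex⟩, hyv⟩
      simp [hSy] at this
    have := one_lt_card.2 ⟨x, hmem x hyx (hxw.trans hwW), w, hmem w hyw hwW, hne⟩
    omega
  have hswap : ∀ P : Finset α, ∑ y ∈ B, (P.filter fun z => G.Adj y z).card =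
      ∑ z ∈ P, outDeg G f A z := by
    intro P
    simp only [outDeg_eq_card_filter]
    exact sum_card_bipartiteAbove_eq_sum_card_bipartiteBelow G.Adj
  have htotal : B.card * 2 ≤ 2 * (S.card * q) + D.card * (T.card + q) := by
    calc B.card * 2 = ∑ y ∈ B, 2 := by simp
      _ ≤ ∑ y ∈ B, (2 * (S.filter fun z => G.Adj y z).card +
          (D.filter fun z => G.Adj y z).card) := sum_le_sum hlow
      _ = 2 * ∑ z ∈ S, outDeg G f A z + ∑ z ∈ D, outDeg G f A z := by
        rw [sum_add_distrib, ← mul_sum, hswap, hswap]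
      _ ≤ 2 * (S.card * q) + D.card * (T.card + q) := by
        gcongr
        · simpa using sum_le_card_nsmul S _ q hS
        · simpa using sum_le_card_nsmul D _ (T.card + q) hD
  rw [hB, ← hSD] at htotal
  by_contra hlt
  nlinarith [Nat.mul_le_mul_left D.card (not_lt.1 hlt)]

/-- A vertex outside `A` has many solo neighbours. -/
lemma le_card_solo {y : α}
    (hdeg : (univ.filter fun w => G.Adj y w).card < Fintype.card κ)
    (hTA : T ⊆ A) (hA : ∀ c ∈ A, ¬ Movable G f y c) :
    outDeg G f A y + T.card + 1 ≤
      (univ.filter fun z => f z ∈ T ∧ Solo G f z y).card + (Aᶜ).card := by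
  have hk := card_add_card_compl A
  have h1 : A.card + (T.filter fun c => 2 ≤ colDeg G f y c).card ≤ ∑ c ∈ A, colDeg G f y c := by
    calc A.card + (T.filter fun c => 2 ≤ colDeg G f y c).card
        ≤ A.card + (A.filter fun c => 2 ≤ colDeg G f y c).card := by gcongr
      _ = ∑ c ∈ A, (1 + if 2 ≤ colDeg G f y c then 1 else 0) := by
        rw [sum_add_distrib, card_filter]; simp
      _ ≤ ∑ c ∈ A, colDeg G f y c := sum_le_sum fun c hc => by
        have := one_le_colDeg (hA c hc)
        split_ifs <;> omega
  have h2 : (T.filter fun c => ¬ 2 ≤ colDeg G f y c).card ≤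
      (univ.filter fun z => f z ∈ T ∧ Solo G f z y).card := by
    refine (card_le_card fun c hc => ?_).trans (card_image_le (f := f))
    obtain ⟨hcT, hc⟩ := mem_filter.1 hc
    have hone : colDeg G f y c = 1 := by
      have := one_le_colDeg (hA c (hTA hcT))
      omega
    obtain ⟨z, hz⟩ := card_eq_one.1 hone
    have hmem : ∀ w, G.Adj y w ∧ f w = c ↔ w = z := fun w => by
      simpa using congrArg (w ∈ ·) hz
    obtain ⟨hyz, hzc⟩ := (hmem z).2 rfl
    refine mem_image.2 ⟨z, ?_, hzc⟩
    simp only [mem_filter, mem_univ, true_and]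
    exact ⟨hzc ▸ hcT, hyz, fun w hyw hw => (hmem w).1 ⟨hyw, hw.trans hzc⟩⟩
  have h3 := card_filter_add_card_filter_not (s := T) (fun c => 2 ≤ colDeg G f y c)
  have h4 := outDeg_add_sum_colDeg (G := G) (f := f) (A := A) y
  omega

/-- An independent subset of `B` whose closed neighbourhoods cover `B`. -/
lemma exists_maximal_independent (G : SimpleGraph α) (B : Finset α) :
    ∃ I ⊆ B, (∀ x ∈ I, ∀ y ∈ I, ¬ G.Adj x y) ∧ ∀ v ∈ B, v ∈ I ∨ ∃ y ∈ I, G.Adj y v := by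
  obtain ⟨I, hI, hmax⟩ := exists_max_image
    (B.powerset.filter fun I => ∀ x ∈ I, ∀ y ∈ I, ¬ G.Adj x y) card
    ⟨∅, by simp⟩
  obtain ⟨hIB, hind⟩ := mem_filter.1 hI
  rw [mem_powerset] at hIB
  refine ⟨I, hIB, hind, fun v hv => ?_⟩
  by_contra! hcon
  have hle := hmax (insert v I) (mem_filter.2 ⟨mem_powerset.2 (insert_subset hv hIB), ?_⟩)
  · rw [card_insert_of_notMem hcon.1] at hle
    omega
  · intro x hx y hy
    rcases mem_insert.1 hx with rfl | hxI <;> rcases mem_insert.1 hy with rfl | hyI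
    · exact G.irrefl
    · exact fun h => hcon.2 y hyI h.symm
    · exact hcon.2 x hxI
    · exact hind x hxI y hyI

lemma exists_nonadjacent_solo {u : κ}
    (hdeg : ∀ v, (univ.filter fun w => G.Adj v w).card < Fintype.card κ)
    (hTA : T ⊆ A) (hTne : T.Nonempty) (hTs : ∀ c ∈ T, (fiber f c).card = s)
    (hA : ∀ v, f v ∉ A → ∀ c ∈ A, ¬ Movable G f v c)
    (hT : ∀ v, f v ∈ T → ∀ c ∈ A, c ∉ T → c ≠ u → ¬ Movable G f v c)
    (hB : (univ.filter fun v => f v ∉ A).card = (Aᶜ).card * s + 1)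
    (hz : ∀ z y, f z ∈ T → f y ∉ A → Solo G f z y → ∀ c ∈ A, c ≠ f z → ¬ Movable G f z c) :
    ∃ z y₁ y₂, f z ∈ T ∧ f y₁ ∉ A ∧ f y₂ ∉ A ∧ y₁ ≠ y₂ ∧ ¬ G.Adj y₁ y₂ ∧
      Solo G f z y₁ ∧ Solo G f z y₂ := by
  obtain ⟨W, hW⟩ := hTne
  have hqt := card_compl_lt_of_solo_not_movable hdeg hTA hW (hTs W hW) hA hT hB hz
  obtain ⟨I, hIB, hind, hcov⟩ := exists_maximal_independent G (univ.filter fun v => f v ∉ A)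
  have hIA : ∀ y ∈ I, f y ∉ A := fun y hy => (mem_filter.1 (hIB hy)).2
  by_contra! hcon
  have hk := card_add_card_compl A
  have hBle : (Aᶜ).card * s + 1 ≤ ∑ y ∈ I, (outDeg G f A y + 1) := by
    rw [← hB]
    refine (card_le_card fun v hv => ?_).trans ((card_biUnion_le (s := I)
      (t := fun y => insert y (univ.filter fun w => G.Adj y w ∧ f w ∉ A))).trans
      (sum_le_sum fun y _ => card_insert_le _ _))
    have hvA := (mem_filter.1 hv).2
    simp only [mem_biUnion, mem_insert, mem_filter, mem_univ, true_and]
    rcases hcov v hv with h | ⟨y, hy, hyv⟩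
    · exact ⟨v, h, .inl rfl⟩
    · exact ⟨y, hy, .inr ⟨hyv, hvA⟩⟩
  have hIle : ∑ y ∈ I, (outDeg G f A y + 1) ≤ I.card * (Aᶜ).card := by
    refine (sum_le_card_nsmul I _ (Aᶜ).card fun y hy => ?_).trans_eq (by simp)
    have h1 := outDeg_add_card_le (subset_refl A) (hA y (hIA y hy))
    have h2 := hdeg y
    omega
  have hsolo : ∑ y ∈ I, (outDeg G f A y + 1) + I.card * T.card ≤
      ∑ y ∈ I, (univ.filter fun z => f z ∈ T ∧ Solo G f z y).card + I.card * (Aᶜ).card := by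
    have := sum_le_sum fun y hy => le_card_solo (hdeg y) hTA (hA y (hIA y hy))
    simp only [sum_add_distrib, sum_const, smul_eq_mul, mul_one] at this ⊢
    omega
  have hswap : ∑ y ∈ I, (univ.filter fun z => f z ∈ T ∧ Solo G f z y).card ≤ T.card * s := by
    have h1 : ∑ y ∈ I, (univ.filter fun z => f z ∈ T ∧ Solo G f z y).card =
        ∑ z ∈ univ.filter (fun z => f z ∈ T), (I.filter fun y => Solo G f z y).card := by
      have h (y : α) : (univ.filter fun z => f z ∈ T ∧ Solo G f z y) =
          (univ.filter fun z => f z ∈ T).filter fun z => Solo G f z y := by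
        rw [filter_filter]
      simp only [h]
      exact sum_card_bipartiteAbove_eq_sum_card_bipartiteBelow (fun y z => Solo G f z y)
    have h2 : (univ.filter fun z => f z ∈ T).card = T.card * s := by
      rw [card_filter_mem, sum_congr rfl hTs]
      simp
    rw [h1, ← h2]
    refine (sum_le_card_nsmul _ _ 1 fun z hz => card_le_one.2 fun y₁ hy₁ y₂ hy₂ => ?_).trans_eq
      (by simp)
    obtain ⟨hy₁, hs₁⟩ := mem_filter.1 hy₁
    obtain ⟨hy₂, hs₂⟩ := mem_filter.1 hy₂
    by_contra hne
    exact hcon z y₁ y₂ (mem_filter.1 hz).2 (hIA _ hy₁) (hIA _ hy₂) hne (hind _ hy₁ _ hy₂) hs₁ hs₂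
  have hIs : s + 1 ≤ I.card := by
    by_contra hlt
    have : I.card ≤ s := by omega
    nlinarith [Nat.mul_le_mul_right (Aᶜ).card this]
  obtain ⟨e, he⟩ := Nat.exists_eq_add_of_lt hqt
  obtain ⟨j, hj⟩ := Nat.exists_eq_add_of_le hIs
  rw [he, hj] at hsolo
  rw [he] at hswap
  nlinarith

end Counting

section Main

variable {α κ : Type*} [Fintype α] [Fintype κ] {G : SimpleGraph α} {s : ℕ}

/-- Every subset of `α` whose size is `s` times the number of available colours, and which induces
a subgraph of smaller maximum degree than that number, is equitably colourable, provided not all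
colours are available. -/
def SubsetColorable (G : SimpleGraph α) (κ : Type*) [Fintype κ] (s : ℕ) : Prop :=
  ∀ (B : Finset α) (D : Finset κ), D.card < Fintype.card κ → B.card = D.card * s →
    (∀ v ∈ B, (B.filter fun w => G.Adj v w).card < D.card) →
    ∃ g : α → κ, (∀ v ∈ B, g v ∈ D) ∧ (∀ v ∈ B, ∀ w ∈ B, G.Adj v w → g v ≠ g w) ∧
      ∀ d ∈ D, (B.filter fun v => g v = d).card = s

lemma card_not_mem_add {f : α → κ} {a b : κ} {A : Finset κ} (hsize : NearlyEquitable s f a b)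
    (ha : a ∈ A) (hb : b ∉ A) : (univ.filter fun v => f v ∉ A).card = (Aᶜ).card * s + 1 := by
  have h1 : (univ.filter fun v => f v ∉ A).card = ∑ c ∈ Aᶜ, (fiber f c).card := by
    simp [← card_filter_mem]
  have h2 : ∀ c ∈ Aᶜ, (fiber f c).card = s + if c = b then 1 else 0 := by
    intro c hc
    rw [← hsize c, if_neg, add_zero]
    rintro rfl
    exact mem_compl.1 hc ha
  rw [h1, sum_congr rfl h2, sum_add_distrib]
  simp [hb]

/-- If the large class is not accessible, some class besides the small one is. -/
lemma accessible_erase_nonempty {f : α → κ} {a b : κ}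
    (hdeg : ∀ v, (univ.filter fun w => G.Adj v w).card < Fintype.card κ)
    (hsize : NearlyEquitable s f a b) (hb : b ∉ accessible (MoveEdge G f) a) :
    ((accessible (MoveEdge G f) a).erase a).Nonempty := by
  have ha : a ∈ accessible (MoveEdge G f) a := mem_accessible.2 .refl
  by_contra hne
  rw [not_nonempty_iff_eq_empty] at hne
  have hA : accessible (MoveEdge G f) a = {a} := by
    rw [← insert_erase ha, hne]
    simp
  have hB := card_not_mem_add hsize ha hb
  have hba : a ≠ b := fun h => hb (h ▸ ha)
  have hsa := hsize a
  rw [if_pos rfl, if_neg hba, add_zero] at hsa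
  have hsum : (univ.filter fun v => f v ∉ accessible (MoveEdge G f) a).card ≤
      ∑ x ∈ fiber f a, (univ.filter fun w => G.Adj x w).card := by
    refine (card_le_card fun v hv => ?_).trans card_biUnion_le
    have hv' := (mem_filter.1 hv).2
    have hm : ¬ Movable G f v a := fun h =>
      hv' (mem_accessible.2 (.single ⟨v, rfl, h⟩))
    simp only [Movable, not_forall, not_not] at hm
    obtain ⟨w, hvw, hw⟩ := hm
    exact mem_biUnion.2 ⟨w, mem_fiber.2 hw, by simpa using hvw.symm⟩
  have hle : ∑ x ∈ fiber f a, (univ.filter fun w => G.Adj x w).card ≤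
      (fiber f a).card * (Fintype.card κ - 1) := by
    simpa using sum_le_card_nsmul (fiber f a) _ (Fintype.card κ - 1)
      (fun x _ => by have := hdeg x; omega)
  have hc : (accessible (MoveEdge G f) a)ᶜ.card = Fintype.card κ - 1 := by
    rw [card_compl, hA, card_singleton]
  rw [hc, ← hsa] at hB
  nlinarith

lemma SubsetColorable.exists_remainder (hsub : SubsetColorable G κ s) {f : α → κ} {a b : κ}
    {A : Finset κ} (hdeg : ∀ v, (univ.filter fun w => G.Adj v w).card < Fintype.card κ)
    (hsize : NearlyEquitable s f a b) (ha : a ∈ A) (hb : b ∉ A)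
    (hA : ∀ v, f v ∉ A → ∀ c ∈ A, ¬ Movable G f v c) {y : α} (hy : f y ∉ A) :
    ∃ g : α → κ, (∀ v, f v ∉ A → v ≠ y → g v ∉ A) ∧
      (∀ v w, f v ∉ A → v ≠ y → f w ∉ A → w ≠ y → G.Adj v w → g v ≠ g w) ∧
      ∀ d ∉ A, (univ.filter fun v => f v ∉ A ∧ v ≠ y ∧ g v = d).card = s := by
  have hk := card_add_card_compl A
  have hApos := card_pos.2 ⟨a, ha⟩
  have hB : (univ.filter fun v => f v ∉ A ∧ v ≠ y) = (univ.filter fun v => f v ∉ A).erase y := by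
    ext v
    simp [and_comm]
  obtain ⟨g, hg1, hg2, hg3⟩ := hsub (univ.filter fun v => f v ∉ A ∧ v ≠ y) Aᶜ (by omega)
    (by rw [hB, card_erase_of_mem (by simpa using hy), card_not_mem_add hsize ha hb]; simp)
    (fun v hv => by
      have hvA : f v ∉ A := by simpa using (mem_filter.1 hv).2.1
      have h1 := outDeg_add_card_le (subset_refl A) (hA v hvA)
      have h2 := hdeg v
      have h3 : ((univ.filter fun v => f v ∉ A ∧ v ≠ y).filter fun w => G.Adj v w).card ≤
          outDeg G f A v := card_le_card fun w hw => by
        simp only [mem_filter, mem_univ, true_and] at hw ⊢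
        exact ⟨hw.2, hw.1.1⟩
      omega)
  refine ⟨g, fun v h1 h2 => ?_, fun v w h1 h2 h3 h4 => ?_, fun d hd => ?_⟩
  · simpa using hg1 v (by simp [h1, h2])
  · exact hg2 v (by simp [h1, h2]) w (by simp [h3, h4])
  · rw [← hg3 d (by simpa using hd), filter_filter]
    simp only [and_assoc]

/-- A nearly equitable colouring can be turned into an equitable one. -/
lemma exists_equitable_of_nearlyEquitable (hsub : SubsetColorable G κ s)
    (hdeg : ∀ v, (univ.filter fun w => G.Adj v w).card < Fintype.card κ) {f : α → κ} {a b : κ}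
    (hf : Proper G f) (hsize : NearlyEquitable s f a b) :
    ∃ g : α → κ, Proper G g ∧ ∀ c, (fiber g c).card = s := by
  induction hn : ((accessible (MoveEdge G f) a)ᶜ).card using Nat.strong_induction_on
    generalizing f a b with
  | _ n ih =>
  set A := accessible (MoveEdge G f) a with hAdef
  have memA : ∀ {c}, c ∈ A ↔ Relation.ReflTransGen (MoveEdge G f) c a := mem_accessible
  have haA : a ∈ A := memA.2 .refl
  by_cases hbA : b ∈ A
  · exact exists_equitable_of_accessible hf hsize (memA.1 hbA)
  obtain ⟨u, hne, hterm⟩ := exists_minimal_cutOff (accessible_erase_nonempty hdeg hsize hbA)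
  set T := cutOff (MoveEdge G f) a u
  have hTA : T ⊆ A := fun c hc => memA.2 (mem_cutOff.1 hc).1
  have haT : a ∉ T := target_not_mem_cutOff
  have hA : ∀ v, f v ∉ A → ∀ c ∈ A, ¬ Movable G f v c := fun v hv c hc hm =>
    hv (memA.2 (.head ⟨v, rfl, hm⟩ (memA.1 hc)))
  have hT : ∀ v, f v ∈ T → ∀ c ∈ A, c ∉ T → c ≠ u → ¬ Movable G f v c := by
    intro v hv c hc hcT hcu hm
    obtain ⟨-, hvu, hva⟩ := mem_cutOff.1 hv
    by_cases hcr : ReachAvoiding (MoveEdge G f) u a c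
    · exact hva (.head ⟨⟨v, rfl, hm⟩, hvu, hcu⟩ hcr)
    · exact hcT (mem_cutOff.2 ⟨memA.1 hc, hcu, hcr⟩)
  have hTs : ∀ c ∈ T, (fiber f c).card = s := by
    intro c hc
    have := hsize c
    rwa [if_neg (ne_of_mem_of_not_mem hc haT),
      if_neg (ne_of_mem_of_not_mem (hTA hc) hbA)] at this
  have havoid : ∀ W ∈ T, ∀ x ∈ A, x ≠ W → ReachAvoiding (MoveEdge G f) W a x := by
    intro W hW x hx hxW
    by_contra hcon
    have : x ∈ cutOff (MoveEdge G f) a W := mem_cutOff.2 ⟨memA.1 hx, hxW, hcon⟩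
    simp [hterm W hW] at this
  by_cases hmov : ∃ z y, f z ∈ T ∧ f y ∉ A ∧ Solo G f z y ∧ ∃ c ∈ A, c ≠ f z ∧ Movable G f z c
  · obtain ⟨z, y, hzT, hyA, hzy, X, hXA, hXz, hX⟩ := hmov
    obtain ⟨g, hg1, hg2, hg3⟩ := hsub.exists_remainder hdeg hsize haA hbA hA hyA
    obtain ⟨h, hh, hhs, hhz, hhy, hhB, hhA⟩ := exists_swap hf hsize haA hbA (hTA hzT) hyA hzy
      hg1 hg2 hg3 hXz (fun w hw hwy _ hgw => hg1 w hw hwy (hgw ▸ hXA)) (fun w _ hzw => hX hzw)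
    obtain ⟨d, hd⟩ := exists_rank
      (fun p q => MoveEdge G f p q ∧ p ≠ f z ∧ q ≠ f z) a
    refine exists_equitable_of_rank {x | x ≠ f z ∧ ReachAvoiding (MoveEdge G f) (f z) a x} d
      hh hhs ⟨hXz, havoid _ hzT X hXA hXz⟩ fun x hx hdx hxa => ?_
    obtain ⟨r, ⟨⟨w, hwx, hw⟩, -, hrz⟩, hr, hrx⟩ := hd x hx.2 hxa
    refine ⟨r, ⟨hrz, hr⟩, hrx, w, ?_, fun v hwv hvr => ?_⟩
    · rw [hhA w (hwx ▸ memA.2 hx.2.reach) (fun h => hx.1 (h ▸ hwx.symm)), hwx]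
    · have hrA : r ∈ A := memA.2 (ReachAvoiding.reach hr)
      have hvz : v ≠ z := by
        rintro rfl
        rw [hhz] at hvr
        subst hvr
        omega
      have hvy : v ≠ y := by
        rintro rfl
        exact hrz (hvr ▸ hhy)
      by_cases hvA : f v ∈ A
      · exact hw hwv ((hhA v hvA hvz).symm.trans hvr)
      · exact hhB v hvA hvy (hvr ▸ hrA)
  · push Not at hmov
    obtain ⟨z, y, y', hzT, hyA, hyA', hyy', hnadj, hzy, hzy'⟩ := exists_nonadjacent_solo hdeg hTA
      hne hTs hA hT (card_not_mem_add hsize haA hbA) hmov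
    obtain ⟨g, hg1, hg2, hg3⟩ := hsub.exists_remainder hdeg hsize haA hbA hA hyA
    have hzA := hTA hzT
    obtain ⟨Y, hYA, hY⟩ : ∃ Y ∉ A, ∀ w, f w ∉ A → w ≠ y → G.Adj z w → g w ≠ Y := by
      by_contra! hcon
      have hsubset : Aᶜ ⊆ ((univ.filter fun w => G.Adj z w ∧ f w ∉ A).erase y).image g := by
        intro c hc
        obtain ⟨w, hwA, hwy, hzw, hwc⟩ := hcon c (mem_compl.1 hc)
        exact mem_image.2 ⟨w, by simp [hwA, hwy, hzw], hwc⟩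
      have h1 := (card_le_card hsubset).trans card_image_le
      rw [card_erase_of_mem (by simp [hyA, hzy.1.symm])] at h1
      have h2 := outDeg_add_card_le (erase_subset (f z) A) (fun c hc =>
        hmov z y hzT hyA hzy c (mem_of_mem_erase hc) (ne_of_mem_erase hc))
      rw [card_erase_of_mem hzA] at h2
      have h3 : 0 < outDeg G f A z := card_pos.2 ⟨y, by simp [hyA, hzy.1.symm]⟩
      have h4 := hdeg z
      have h5 := card_add_card_compl A
      unfold outDeg at h2 h3
      omega
    obtain ⟨h, hh, hhs, hhz, hhy, hhB, hhA⟩ := exists_swap hf hsize haA hbA hzA hyA hzy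
      hg1 hg2 hg3 (fun h => hYA (by rwa [h])) hY (fun w hw _ hwY => hYA (hwY ▸ hw))
    have hkeep : ∀ w c, c ∈ A → c ≠ f z → Movable G f w c → Movable G h w c := by
      intro w c hcA hcz hm v hwv hvc
      have hvz : v ≠ z := by
        rintro rfl
        exact hYA (hhz ▸ hvc ▸ hcA)
      have hvy : v ≠ y := by
        rintro rfl
        exact hcz (hvc ▸ hhy)
      by_cases hvA : f v ∈ A
      · exact hm hwv ((hhA v hvA hvz).symm.trans hvc)
      · exact hhB v hvA hvy (hvc ▸ hcA)
    have hreach : ∀ x, ReachAvoiding (MoveEdge G f) (f z) a x →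
        Relation.ReflTransGen (MoveEdge G h) x a := by
      intro x hx
      induction hx using Relation.ReflTransGen.head_induction_on with
      | refl => exact .refl
      | head hpq hr ihr =>
        obtain ⟨⟨w, hwp, hw⟩, hpz, hqz⟩ := hpq
        have hqA := memA.2 (ReachAvoiding.reach hr)
        have hwA : f w ∈ A := memA.2 (.head ⟨w, rfl, hw⟩ (memA.1 hqA))
        refine .head ⟨w, ?_, hkeep w _ hqA hqz hw⟩ ihr
        rw [hhA w hwA (fun h => hpz (h ▸ hwp.symm)), hwp]
    have hzreach : Relation.ReflTransGen (MoveEdge G h) (f z) a := by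
      obtain ⟨c, ⟨w, hwz, hw⟩, hcz, hc⟩ := exists_step_avoiding (memA.1 hzA)
        (fun h => haT (h ▸ hzT))
      have hcA := memA.2 hc.reach
      refine .head ⟨w, ?_, hkeep w c hcA hcz hw⟩ (hreach c hc)
      rw [hhA w (hwz ▸ hzA) ?_, hwz]
      rintro rfl
      exact hmov w y hzT hyA hzy c hcA hcz hw
    have hyreach : Relation.ReflTransGen (MoveEdge G h) (h y') a := by
      refine .head ⟨y', rfl, fun v hyv hv => ?_⟩ hzreach
      have hvz : v ≠ z := by
        rintro rfl
        exact hYA (hhz ▸ hv ▸ hzA)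
      have hvy : v ≠ y := by
        rintro rfl
        exact hnadj hyv.symm
      by_cases hvA : f v ∈ A
      · exact hvz (hzy'.2 hyv ((hhA v hvA hvz).symm.trans hv))
      · exact hhB v hvA hvy (hv ▸ hzA)
    refine ih _ ?_ hh hhs rfl
    rw [← hn]
    refine card_lt_card (ssubset_iff_of_subset ?_ |>.2
      ⟨h y', mem_compl.2 (hhB y' hyA' hyy'.symm), ?_⟩)
    · refine compl_subset_compl.2 fun x hx => mem_accessible.2 ?_
      by_cases hxz : x = f z
      · exact hxz ▸ hzreach
      · exact hreach x (havoid _ hzT x hx hxz)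
    · simpa [mem_accessible] using hyreach

end Main

/-- A graph on `k * s` vertices with all degrees less than `k` has an equitable `k`-colouring. -/
theorem exists_equitable_coloring.{u} (s k : ℕ) : ∀ (α : Type u) (κ : Type) [Fintype α] [Fintype κ]
    (G : SimpleGraph α), Fintype.card κ = k → Fintype.card α = k * s →
    (∀ v, (univ.filter fun w => G.Adj v w).card < k) →
    ∃ g : α → κ, Proper G g ∧ ∀ c, (fiber g c).card = s := by
  induction k using Nat.strong_induction_on with
  | _ k ih =>
  intro α κ _ _ G hκ hα hdeg
  have hsub : ∀ H : SimpleGraph α, SubsetColorable H κ s := by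
    intro H B D hD hB hdegB
    obtain ⟨g, hg, hgs⟩ := ih D.card (hκ ▸ hD) B D (H.comap Subtype.val) (by simp)
      (by simpa using hB) (fun v => by
        refine lt_of_le_of_lt ?_ (hdegB v v.2)
        refine card_le_card_of_injOn Subtype.val (fun w hw => ?_) Subtype.val_injective.injOn
        simpa using hw)
    by_cases hDne : Nonempty κ
    · refine ⟨fun v => if hv : v ∈ B then g ⟨v, hv⟩ else Classical.arbitrary κ, ?_, ?_, ?_⟩
      · intro v hv
        simp [hv]
      · intro v hv w hw hvw
        simp only [hv, hw, dite_true]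
        exact fun h => hg (v := ⟨v, hv⟩) (w := ⟨w, hw⟩) hvw (Subtype.ext h)
      · intro d hd
        rw [← hgs ⟨d, hd⟩]
        symm
        refine card_bij (fun v _ => v.1) ?_ (fun _ _ _ _ h => Subtype.ext h) ?_
        · intro v hv
          have := mem_fiber.1 hv
          simp [this]
        · intro v hv
          obtain ⟨hvB, hvd⟩ := mem_filter.1 hv
          simp only [hvB, dite_true] at hvd
          exact ⟨⟨v, hvB⟩, mem_fiber.2 (Subtype.ext hvd), rfl⟩
    · rw [not_nonempty_iff] at hDne
      rw [Fintype.card_eq_zero] at hD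
      omega
  obtain ⟨H, hHadj⟩ : ∃ H : Finset α → SimpleGraph α,
      ∀ P v w, (H P).Adj v w ↔ G.Adj v w ∧ v ∈ P ∧ w ∈ P :=
    ⟨fun P =>
      { Adj := fun v w => G.Adj v w ∧ v ∈ P ∧ w ∈ P
        symm := ⟨fun _ _ h => ⟨h.1.symm, h.2.2, h.2.1⟩⟩
        loopless := ⟨fun _ h => G.irrefl h.1⟩ }, fun _ _ _ => Iff.rfl⟩
  have hH : ∀ P v, (univ.filter fun w => (H P).Adj v w).card < Fintype.card κ := fun P v => by
    refine hκ ▸ lt_of_le_of_lt (card_le_card fun w hw => ?_) (hdeg v)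
    have hw' : (H P).Adj v w := by simpa using hw
    simpa using ((hHadj P v w).1 hw').1
  have main : ∀ P, ∃ g : α → κ, Proper (H P) g ∧ ∀ c, (fiber g c).card = s := by
    intro P
    induction P using Finset.induction_on with
    | empty =>
      have e : α ≃ κ × Fin s := Fintype.equivOfCardEq (by simp [hα, hκ])
      refine ⟨fun v => (e v).1, fun v w h => by simpa using ((hHadj _ v w).1 h).2.1, fun c => ?_⟩
      refine Eq.trans (Eq.symm ?_) (card_fin s)
      refine card_bij (fun i _ => e.symm (c, i)) ?_ ?_ ?_
      · intro i _
        simp [mem_fiber]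
      · intro i _ j _ hij
        simpa using hij
      · intro v hv
        refine ⟨(e v).2, mem_univ _, ?_⟩
        rw [← mem_fiber.1 hv]
        simp
    | insert u P _ ihP =>
      obtain ⟨f, hf, hfs⟩ := ihP
      obtain ⟨c, hc⟩ : ∃ c, Movable (H (insert u P)) f u c := by
        by_contra! hcon
        refine absurd (hH (insert u P) u) (not_lt.2 ?_)
        rw [← card_univ]
        refine (card_le_card fun c _ => ?_).trans (card_image_le (f := f))
        have := hcon c
        simp only [Movable, not_forall, not_not] at this
        obtain ⟨w, hw, hwc⟩ := this
        exact mem_image.2 ⟨w, by simpa using hw, hwc⟩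
      refine exists_equitable_of_nearlyEquitable (hsub _) (hH _)
        (f := Function.update f u c) (a := f u) (b := c) ?_ fun d => ?_
      · intro v w hvw
        by_cases hv : v = u
        · subst hv
          rw [Function.update_self, Function.update_of_ne hvw.ne']
          exact (hc hvw).symm
        by_cases hw : w = u
        · subst hw
          rw [Function.update_self, Function.update_of_ne hv]
          exact hc hvw.symm
        · rw [Function.update_of_ne hv, Function.update_of_ne hw]
          obtain ⟨hadj, hvP, hwP⟩ := (hHadj _ v w).1 hvw
          exact hf ((hHadj P v w).2
            ⟨hadj, mem_of_mem_insert_of_ne hvP hv, mem_of_mem_insert_of_ne hwP hw⟩)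
      · rw [card_fiber_update, hfs]
  obtain ⟨g, hg, hgs⟩ := main univ
  exact ⟨g, fun v w h => hg ((hHadj _ v w).2 ⟨h, mem_univ _, mem_univ _⟩), hgs⟩

/-- Hajnal–Szemerédi: if `G` has `n = s·m` vertices and
minimum degree at least `(s−1)·m`, then `G` can be tiled with `K_s`. -/
theorem hajnal_szemeredi (s m : ℕ) (hs : 1 ≤ s)
    (V : Type*) [Fintype V] [DecidableEq V] (G : SimpleGraph V)
    (hcard : Fintype.card V = s * m)
    (hdeg : ∀ v : V, (s - 1) * m ≤ degS G v Finset.univ) :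
    CliqueTileable G s := by
  obtain ⟨f, hf, hfs⟩ := exists_equitable_coloring s m V (Fin m) Gᶜ (by simp)
    (by rw [hcard, mul_comm]) (fun v => by
      have h1 := hdeg v
      rw [degS] at h1
      have h2 := card_filter_add_card_filter_not (s := (univ : Finset V)) (fun w => G.Adj v w)
      rw [card_univ, hcard] at h2
      have h3 : (univ.filter fun w => Gᶜ.Adj v w) =
          (univ.filter fun w => ¬ G.Adj v w).erase v := by
        ext w
        simp [SimpleGraph.compl_adj, eq_comm]
      refine lt_of_eq_of_lt (b := ((univ.filter fun w => ¬ G.Adj v w).erase v).card)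
        (by convert congrArg card h3) ?_
      rw [card_erase_of_mem (by simp)]
      have h4 : s * m = (s - 1) * m + m := by
        obtain ⟨r, rfl⟩ := Nat.exists_eq_add_of_le' hs
        simp [add_mul]
      have h5 : 0 < (univ.filter fun w => ¬ G.Adj v w).card := card_pos.2 ⟨v, by simp⟩
      omega)
  refine ⟨univ.image (fiber f), fun S hS => ?_, fun S hS T hT hST => ?_, ?_⟩
  · obtain ⟨c, -, rfl⟩ := mem_image.1 hS
    refine ⟨hfs c, fun v hv w hw hvw => ?_⟩
    by_contra hadj
    exact hf ((G.compl_adj v w).2 ⟨hvw, hadj⟩)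
      ((mem_fiber.1 hv).trans (mem_fiber.1 hw).symm)
  · obtain ⟨c, -, rfl⟩ := mem_image.1 hS
    obtain ⟨d, -, rfl⟩ := mem_image.1 hT
    refine disjoint_left.2 fun v hv hv' => hST ?_
    rw [← mem_fiber.1 hv, ← mem_fiber.1 hv']
  · ext v
    simp only [mem_sup, mem_univ, iff_true]
    exact ⟨fiber f (f v), mem_image_of_mem _ (mem_univ _), mem_fiber.2 rfl⟩

end PaperTiling
end

section
/- Let s ≥ 2 and n = ms ≥ 64s². There exists a balanced bipartite graph G on 2n vertices with δ(G) = n/2 + s − 2 if m is even, and δ(G) = (n+3s)/2 − 3 if m is odd, such that G cannot be tiled with K_{s,s}. -/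
open scoped Classical
open Finset

namespace PaperTiling

variable {V : Type*} [Fintype V] [DecidableEq V]

section Transport

variable {V W : Type*} [Fintype V] [Fintype W]

lemma degS_comap (H : SimpleGraph W) (e : V ≃ W) (v : V) :
    degS (H.comap e) v univ = degS H (e v) univ :=
  Finset.card_equiv e fun w => by simp

lemma MinDegreeIs.comap {H : SimpleGraph W} {c : ℝ} (h : MinDegreeIs H c) (e : V ≃ W) :
    MinDegreeIs (H.comap e) c := by
  obtain ⟨h₁, w, hw⟩ := h
  refine ⟨fun v => ?_, e.symm w, ?_⟩
  · rw [degS_comap]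
    exact h₁ _
  · rw [degS_comap, e.apply_symm_apply, hw]

variable [DecidableEq V] [DecidableEq W]

lemma IsBipartition.comap {H : SimpleGraph W} {A B : Finset W} (h : IsBipartition H A B)
    (e : V ≃ W) :
    IsBipartition (H.comap e) (A.map e.symm.toEmbedding) (B.map e.symm.toEmbedding) := by
  obtain ⟨h₁, h₂, h₃⟩ := h
  refine ⟨(Finset.disjoint_map _).2 h₁, ?_, fun u v huv => ?_⟩
  · rw [← Finset.map_union, h₂, Finset.map_univ_equiv]
  · simpa [Finset.mem_map_equiv] using h₃ _ _ huv

lemma KstTileable.of_comap {H : SimpleGraph W} {s t : ℕ} {e : V ≃ W}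
    (h : KstTileable (H.comap e) s t) : KstTileable H s t := by
  obtain ⟨𝒯, h₁, h₂, h₃⟩ := h
  refine ⟨𝒯.image fun P => (P.1.map e.toEmbedding, P.2.map e.toEmbedding), ?_, ?_, ?_⟩
  · intro P' hP'
    obtain ⟨P, hP, rfl⟩ := Finset.mem_image.1 hP'
    obtain ⟨a, b, c, d⟩ := h₁ P hP
    refine ⟨(Finset.disjoint_map _).2 a, by simpa using b, by simpa using c, ?_⟩
    intro u hu v hv
    simpa using d _ (Finset.mem_map_equiv.1 hu) _ (Finset.mem_map_equiv.1 hv)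
  · intro P' hP' Q' hQ' hne
    obtain ⟨P, hP, rfl⟩ := Finset.mem_image.1 (Finset.mem_coe.1 hP')
    obtain ⟨Q, hQ, rfl⟩ := Finset.mem_image.1 (Finset.mem_coe.1 hQ')
    have hPQ : P ≠ Q := by
      rintro rfl
      exact hne rfl
    simp only [Function.onFun, ← Finset.map_union]
    exact (Finset.disjoint_map _).2 (h₂ hP hQ hPQ)
  · ext w
    have hw : e.symm w ∈ 𝒯.sup fun P => P.1 ∪ P.2 := h₃ ▸ Finset.mem_univ _
    rw [Finset.mem_sup] at hw ⊢
    obtain ⟨P, hP, hw⟩ := hw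
    refine iff_of_true ⟨_, Finset.mem_image_of_mem _ hP, ?_⟩ (Finset.mem_univ _)
    simpa [Finset.mem_map_equiv] using hw

end Transport

lemma IsKst.symm {V : Type*} {G : SimpleGraph V} {s t : ℕ}
    {S T : Finset V} (h : IsKst G s t S T) : IsKst G t s T S :=
  ⟨h.1.symm, h.2.2.1, h.2.1, fun u hu v hv => (h.2.2.2 v hv u hu).symm⟩

lemma IsKstTiling.sum_card {V X : Type*} [Fintype V] [DecidableEq V] [Fintype X]
    {G : SimpleGraph V} {s t : ℕ} {𝒯 : Finset (Finset V × Finset V)}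
    (h : IsKstTiling G s t 𝒯) (g : X → V) :
    ∑ P ∈ 𝒯, #{x | g x ∈ P.1 ∪ P.2} = Fintype.card X := by
  obtain ⟨-, h₂, h₃⟩ := h
  rw [← Finset.card_biUnion, ← Finset.card_univ]
  · congr 1
    ext x
    have hx : g x ∈ 𝒯.sup fun P => P.1 ∪ P.2 := h₃ ▸ Finset.mem_univ _
    rw [Finset.mem_sup] at hx
    simpa using hx
  · intro P hP Q hQ hPQ
    refine Finset.disjoint_left.2 fun x hx hx' => ?_
    exact Finset.disjoint_left.1 (h₂ hP hQ hPQ) (Finset.mem_filter.1 hx).2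
      (Finset.mem_filter.1 hx').2

section BlockGraph

lemma card_eq_sum_blocks {P Q : Type*} [Fintype P] [Fintype Q] [DecidableEq P] [DecidableEq Q]
    (S : Finset ((P ⊕ Q) ⊕ (Q ⊕ P))) :
    #S = #{x : P | .inl (.inl x) ∈ S} + #{x : Q | .inl (.inr x) ∈ S} +
      (#{y : Q | .inr (.inl y) ∈ S} + #{y : P | .inr (.inr y) ∈ S}) := by
  have h : #S = #{v | v ∈ S} := by simp
  rw [h]
  simp only [Finset.card_filter, Fintype.sum_sum_type]

variable {P Q : Type*} [AddCommGroup P] [AddCommGroup Q]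

/-- The relation between `P ⊕ Q` and `Q ⊕ P` which is complete on the pairs `(P, Q)` and `(Q, P)`
and is given by differences in `D` and in `E` on the pairs `(P, P)` and `(Q, Q)`. -/
def blockRel (D : Finset P) (E : Finset Q) : P ⊕ Q → Q ⊕ P → Prop
  | .inl _, .inl _ => True
  | .inl x, .inr y => y - x ∈ D
  | .inr x, .inl y => y - x ∈ E
  | .inr _, .inr _ => True

/-- The bipartite graph of `blockRel D E`. -/
def blockGraph (D : Finset P) (E : Finset Q) : SimpleGraph ((P ⊕ Q) ⊕ (Q ⊕ P)) where
  Adj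
    | .inl x, .inr y => blockRel D E x y
    | .inr y, .inl x => blockRel D E x y
    | _, _ => False
  symm := ⟨by rintro (x | x) (y | y) h <;> exact h⟩
  loopless := ⟨by rintro (x | x) h <;> exact h⟩

@[simp] lemma blockGraph_adj_inl_inr {D : Finset P} {E : Finset Q} {x : P ⊕ Q} {y : Q ⊕ P} :
    (blockGraph D E).Adj (.inl x) (.inr y) ↔ blockRel D E x y := Iff.rfl

@[simp] lemma blockGraph_adj_inr_inl {D : Finset P} {E : Finset Q} {x : P ⊕ Q} {y : Q ⊕ P} :
    (blockGraph D E).Adj (.inr y) (.inl x) ↔ blockRel D E x y := Iff.rfl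

@[simp] lemma blockGraph_adj_inl_inl {D : Finset P} {E : Finset Q} {x y : P ⊕ Q} :
    (blockGraph D E).Adj (.inl x) (.inl y) ↔ False := Iff.rfl

@[simp] lemma blockGraph_adj_inr_inr {D : Finset P} {E : Finset Q} {x y : Q ⊕ P} :
    (blockGraph D E).Adj (.inr x) (.inr y) ↔ False := Iff.rfl

lemma card_filter_sub_mem [Fintype P] (D : Finset P) (x : P)
    [DecidablePred fun y => y - x ∈ D] : #{y | y - x ∈ D} = #D :=
  Finset.card_equiv (Equiv.subRight x) fun y => by simp

lemma card_filter_sub_mem' [Fintype P] (D : Finset P) (y : P)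
    [DecidablePred fun x => y - x ∈ D] : #{x | y - x ∈ D} = #D :=
  Finset.card_equiv (Equiv.subLeft y) fun x => by simp

variable [Fintype P] [Fintype Q] [DecidableEq Q] {D : Finset P} {E : Finset Q}

lemma degS_blockGraph_inl_inr (D : Finset P) (E : Finset Q) (x : Q) :
    degS (blockGraph D E) (.inl (.inr x)) univ = Fintype.card P + #E := by
  unfold degS
  rw [Finset.card_filter]
  simp only [Fintype.sum_sum_type]
  simp [blockRel, card_filter_sub_mem, add_comm]

variable [DecidableEq P]

lemma degS_blockGraph (D : Finset P) (E : Finset Q) (v : (P ⊕ Q) ⊕ (Q ⊕ P)) :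
    degS (blockGraph D E) v univ = Fintype.card Q + #D ∨
      degS (blockGraph D E) v univ = Fintype.card P + #E := by
  unfold degS
  rw [Finset.card_filter]
  simp only [Fintype.sum_sum_type]
  rcases v with (x | x) | (y | y) <;>
    simp [blockRel, card_filter_sub_mem, card_filter_sub_mem', add_comm]

lemma minDegreeIs_blockGraph [Nonempty Q]
    (h : Fintype.card P + #E ≤ Fintype.card Q + #D) {c : ℝ}
    (hc : c = ((Fintype.card P + #E : ℕ) : ℝ)) : MinDegreeIs (blockGraph D E) c := by
  subst hc
  refine ⟨fun v => ?_, .inl (.inr (Classical.arbitrary Q)), ?_⟩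
  · rcases degS_blockGraph D E v with hv | hv
    · rw [hv]
      exact_mod_cast h
    · rw [hv]
  · rw [degS_blockGraph_inl_inr]

lemma isBipartition_blockGraph (D : Finset P) (E : Finset Q) :
    IsBipartition (blockGraph D E) (univ.map .inl) (univ.map .inr) := by
  refine ⟨?_, ?_, ?_⟩
  · rw [Finset.disjoint_left]
    simp
  · ext (v | v) <;> simp
  · rintro (u | u) (v | v) h
    all_goals simp_all

/-- If `E` is a Sidon set, a copy of `K_{s,s}` in `blockGraph D E` meets the first parts of the two
sides in `0` and `0`, in `s` and `s`, or, when `s ≤ #E`, in `0` and `1` or in `s - 1` and `s`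
vertices. -/
lemma IsKst.card_blocks {s : ℕ} (hD : #D + 2 ≤ s)
    (hE : ∀ a ∈ E, ∀ b ∈ E, ∀ c ∈ E, ∀ d ∈ E, a + b = c + d → a = c ∨ a = d)
    {S T : Finset ((P ⊕ Q) ⊕ (Q ⊕ P))} (h : IsKst (blockGraph D E) s s S T) {a b : ℕ}
    (ha : #{x : P | .inl (.inl x) ∈ S ∪ T} = a) (hb : #{y : Q | .inr (.inl y) ∈ S ∪ T} = b) :
    (a = 0 ∧ b = 0) ∨ (a = s ∧ b = s) ∨
      (s ≤ #E ∧ ((a = 0 ∧ b = 1) ∨ (a + 1 = s ∧ b = s))) := by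
  wlog hS : ∃ x, Sum.inl x ∈ S generalizing S T
  · refine this h.symm (by rwa [union_comm]) (by rwa [union_comm]) ?_
    obtain ⟨u, hu⟩ : S.Nonempty := Finset.card_pos.1 (by have := h.2.1; omega)
    obtain ⟨v, hv⟩ : T.Nonempty := Finset.card_pos.1 (by have := h.2.2.1; omega)
    have huv := h.2.2.2 u hu v hv
    rcases u with u | u
    · exact absurd ⟨u, hu⟩ hS
    · rcases v with v | v
      · exact ⟨v, hv⟩
      · simp at huv
  obtain ⟨-, hSs, hTs, hadj⟩ := h
  obtain ⟨x₀, hx₀⟩ := hS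
  have hT : ∀ x, Sum.inl x ∉ T := fun x hx => by simpa using hadj _ hx₀ _ hx
  obtain ⟨y₀, hy₀⟩ : ∃ y, Sum.inr y ∈ T := by
    obtain ⟨v, hv⟩ : T.Nonempty := Finset.card_pos.1 (by omega)
    rcases v with v | v
    · exact absurd hv (hT v)
    · exact ⟨v, hv⟩
  have hS : ∀ y, Sum.inr y ∉ S := fun y hy => by simpa using hadj _ hy _ hy₀
  rw [card_eq_sum_blocks] at hSs hTs
  replace ha : #{x : P | .inl (.inl x) ∈ S} = a := by
    rw [← ha]
    congr 1
    ext x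
    simp [hT]
  replace hb : #{y : Q | .inr (.inl y) ∈ T} = b := by
    rw [← hb]
    congr 1
    ext y
    simp [hS]
  simp only [hS, Finset.filter_false, Finset.card_empty, add_zero] at hSs
  simp only [hT, Finset.filter_false, Finset.card_empty, zero_add] at hTs
  rw [ha] at hSs
  rw [hb] at hTs
  have star₁ : 1 ≤ a → #{y : P | .inr (.inr y) ∈ T} ≤ #D := fun h₁ => by
    obtain ⟨x, hx⟩ := Finset.card_pos.1 (ha ▸ h₁)
    rw [← card_filter_sub_mem D x]
    refine Finset.card_le_card fun y hy => ?_
    simp only [Finset.mem_filter, Finset.mem_univ, true_and] at hx hy ⊢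
    exact hadj _ hx _ hy
  have star₂ : 1 ≤ #{y : P | .inr (.inr y) ∈ T} → a ≤ #D := fun h₁ => by
    obtain ⟨y, hy⟩ := Finset.card_pos.1 h₁
    rw [← card_filter_sub_mem' D y, ← ha]
    refine Finset.card_le_card fun x hx => ?_
    simp only [Finset.mem_filter, Finset.mem_univ, true_and] at hx hy ⊢
    exact hadj _ hx _ hy
  have star₃ : 1 ≤ #{x : Q | .inl (.inr x) ∈ S} → b ≤ #E := fun h₁ => by
    obtain ⟨x, hx⟩ := Finset.card_pos.1 h₁
    rw [← card_filter_sub_mem E x, ← hb]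
    refine Finset.card_le_card fun y hy => ?_
    simp only [Finset.mem_filter, Finset.mem_univ, true_and] at hx hy ⊢
    exact hadj _ hx _ hy
  have star₄ : 1 ≤ b → #{x : Q | .inl (.inr x) ∈ S} ≤ #E := fun h₁ => by
    obtain ⟨y, hy⟩ := Finset.card_pos.1 (hb ▸ h₁)
    rw [← card_filter_sub_mem' E y]
    refine Finset.card_le_card fun x hx => ?_
    simp only [Finset.mem_filter, Finset.mem_univ, true_and] at hx hy ⊢
    exact hadj _ hx _ hy
  have cycle : ¬ (1 < #{x : Q | .inl (.inr x) ∈ S} ∧ 1 < b) := by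
    rintro ⟨h₁, h₂⟩
    rw [← hb] at h₂
    obtain ⟨x, hx, x', hx', hxx⟩ := Finset.one_lt_card.1 h₁
    obtain ⟨y, hy, y', hy', hyy⟩ := Finset.one_lt_card.1 h₂
    simp only [Finset.mem_filter, Finset.mem_univ, true_and] at hx hx' hy hy'
    rcases hE (y - x) (hadj _ hx _ hy) (y' - x') (hadj _ hx' _ hy') (y - x') (hadj _ hx' _ hy)
      (y' - x) (hadj _ hx _ hy') (by abel) with h | h
    · exact hxx (sub_right_injective h)
    · exact hyy (sub_left_injective h)
  omega

lemma not_kstTileable_blockGraph_of_card_lt {s : ℕ} (hD : #D + 2 ≤ s) (hEs : #E < s)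
    (hE : ∀ a ∈ E, ∀ b ∈ E, ∀ c ∈ E, ∀ d ∈ E, a + b = c + d → a = c ∨ a = d)
    (hPQ : Fintype.card P ≠ Fintype.card Q) : ¬ KstTileable (blockGraph D E) s s := by
  rintro ⟨𝒯, h⟩
  apply hPQ
  rw [← h.sum_card fun x : P => .inl (.inl x), ← h.sum_card fun y : Q => .inr (.inl y)]
  refine Finset.sum_congr rfl fun K hK => ?_
  have := (h.1 K hK).card_blocks hD hE rfl rfl
  omega

lemma not_kstTileable_blockGraph_of_lt_mod {s : ℕ} (hD : #D + 2 ≤ s)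
    (hE : ∀ a ∈ E, ∀ b ∈ E, ∀ c ∈ E, ∀ d ∈ E, a + b = c + d → a = c ∨ a = d)
    (hPQ : Fintype.card Q < Fintype.card P + Fintype.card Q % s) :
    ¬ KstTileable (blockGraph D E) s s := by
  rintro ⟨𝒯, h⟩
  have hQ := h.sum_card fun y : Q => .inr (.inl y)
  have hmod : Fintype.card Q % s ≤
      ∑ K ∈ 𝒯, #{y : Q | .inr (.inl y) ∈ K.1 ∪ K.2} % s := by
    rw [← hQ, Finset.sum_nat_mod]
    exact Nat.mod_le _ _
  refine hPQ.not_ge ((add_le_add_right hmod _).trans ?_)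
  rw [← h.sum_card fun x : P => .inl (.inl x), ← hQ, ← Finset.sum_add_distrib]
  refine Finset.sum_le_sum fun K hK => ?_
  rcases (h.1 K hK).card_blocks hD hE rfl rfl with
    ⟨h₁, h₂⟩ | ⟨h₁, h₂⟩ | ⟨-, ⟨h₁, h₂⟩ | ⟨h₁, h₂⟩⟩
  · rw [h₁, h₂]
    simp
  · rw [h₁, h₂]
    simp
  · rw [h₁, h₂, Nat.mod_eq_of_lt (by omega)]
  · rw [h₂, Nat.mod_self]
    omega

end BlockGraph

/-- The Erdős–Turán construction of a Sidon set. -/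
lemma erdosTuran_sidon {p d : ℕ} (hp : p.Prime) (hd : d < p) (hpd : p ≤ 2 * d) {i j k l : ℕ}
    (hi : i < d) (hj : j < d) (hk : k < d) (hl : l < d)
    (h : (2 * p * i + i ^ 2 % p) + (2 * p * j + j ^ 2 % p) =
      (2 * p * k + k ^ 2 % p) + (2 * p * l + l ^ 2 % p)) : i = k ∨ i = l := by
  have hr : ∀ x, x ^ 2 % p < p := fun x => Nat.mod_lt _ hp.pos
  have key : ∀ x y, (2 * p * x + x ^ 2 % p + (2 * p * y + y ^ 2 % p)) / (2 * p) = x + y := by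
    intro x y
    have := hr x
    have := hr y
    rw [show 2 * p * x + x ^ 2 % p + (2 * p * y + y ^ 2 % p) =
      (x ^ 2 % p + y ^ 2 % p) + 2 * p * (x + y) by ring,
      Nat.add_mul_div_left _ _ (by omega), Nat.div_eq_of_lt (by omega), zero_add]
  have hsum : i + j = k + l := by rw [← key i j, h, key]
  have hres : i ^ 2 % p + j ^ 2 % p = k ^ 2 % p + l ^ 2 % p := by
    have : 2 * p * i + 2 * p * j = 2 * p * k + 2 * p * l := by
      rw [← mul_add, hsum, mul_add]
    omega
  have hsq : i ^ 2 + j ^ 2 ≡ k ^ 2 + l ^ 2 [MOD p] := by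
    unfold Nat.ModEq
    rw [Nat.add_mod, hres, ← Nat.add_mod]
  have hdvd : (p : ℤ) ∣ 2 * ((i - k) * (i - l)) := by
    have h₁ := (Nat.modEq_iff_dvd.1 hsq.symm)
    have h₂ : (j : ℤ) = k + l - i := by omega
    push_cast at h₁
    rw [h₂] at h₁
    convert h₁ using 1
    ring
  have small : ∀ x y : ℕ, x < d → y < d → (p : ℤ) ∣ (x : ℤ) - y → x = y := by
    intro x y hx hy hxy
    have := Int.eq_zero_of_abs_lt_dvd hxy (by rw [abs_lt]; omega)
    omega
  have hp' := Nat.prime_iff_prime_int.1 hp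
  rcases hp'.dvd_or_dvd hdvd with h₁ | h₁
  · have := Int.le_of_dvd (by norm_num) h₁
    have := hp.two_le
    omega
  · rcases hp'.dvd_or_dvd h₁ with h₂ | h₂
    · exact .inl (small _ _ hi hk h₂)
    · exact .inr (small _ _ hi hl h₂)

lemma exists_sidon_zmod {q d : ℕ} (hq : 8 * d ^ 2 ≤ q) :
    ∃ E : Finset (ZMod q), #E = d ∧
      ∀ a ∈ E, ∀ b ∈ E, ∀ c ∈ E, ∀ e ∈ E, a + b = c + e → a = c ∨ a = e := by
  rcases Nat.eq_zero_or_pos d with rfl | hd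
  · exact ⟨∅, by simp⟩
  obtain ⟨p, hp, hdp, hpd⟩ := Nat.exists_prime_lt_and_le_two_mul d hd.ne'
  set f : ℕ → ℕ := fun k => 2 * p * k + k ^ 2 % p with hf
  have hfq : ∀ k < d, 2 * f k < q := by
    intro k hk
    have h₁ : k ^ 2 % p < p := Nat.mod_lt _ hp.pos
    simp only [hf]
    nlinarith [Nat.mul_le_mul_left p (Nat.succ_le_of_lt hk), Nat.mul_le_mul_right d hpd]
  have hsidon : ∀ i < d, ∀ j < d, ∀ k < d, ∀ l < d,
      (f i : ZMod q) + f j = f k + f l → i = k ∨ i = l := by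
    intro i hi j hj k hk l hl h
    refine erdosTuran_sidon hp hdp hpd hi hj hk hl ?_
    have h' : ((f i + f j : ℕ) : ZMod q) = (f k + f l : ℕ) := by exact_mod_cast h
    rw [ZMod.natCast_eq_natCast_iff] at h'
    have := hfq i hi
    have := hfq j hj
    have := hfq k hk
    have := hfq l hl
    exact h'.eq_of_lt_of_lt (by omega) (by omega)
  refine ⟨(range d).image fun k => (f k : ZMod q), ?_, ?_⟩
  · rw [Finset.card_image_of_injOn, card_range]
    intro i hi j hj hij
    rw [Finset.coe_range, Set.mem_Iio] at hi hj
    have h₁ : (f i : ZMod q) = f j := hij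
    simpa using hsidon i hi i hi j hj j hj (by rw [h₁])
  · simp only [Finset.mem_image, Finset.mem_range]
    rintro _ ⟨i, hi, rfl⟩ _ ⟨j, hj, rfl⟩ _ ⟨k, hk, rfl⟩ _ ⟨l, hl, rfl⟩ h
    rcases hsidon i hi j hj k hk l hl h with rfl | rfl
    · exact .inl rfl
    · exact .inr rfl

lemma exists_graph_of_blockGraph {P Q : Type*} [AddCommGroup P] [AddCommGroup Q] [Fintype P]
    [Fintype Q] [DecidableEq P] [DecidableEq Q] {D : Finset P} {E : Finset Q} {n s : ℕ} {c : ℝ}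
    (hn : Fintype.card P + Fintype.card Q = n) (hc : MinDegreeIs (blockGraph D E) c)
    (ht : ¬ KstTileable (blockGraph D E) s s) :
    ∃ (G : SimpleGraph (Fin (2 * n))) (A B : Finset (Fin (2 * n))),
      IsBipartition G A B ∧ #A = n ∧ #B = n ∧ MinDegreeIs G c ∧ ¬ KstTileable G s s := by
  have e : Fin (2 * n) ≃ (P ⊕ Q) ⊕ (Q ⊕ P) :=
    Fintype.equivOfCardEq (by simp only [Fintype.card_fin, Fintype.card_sum]; omega)
  refine ⟨(blockGraph D E).comap e, _, _, (isBipartition_blockGraph D E).comap e, ?_, ?_,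
    hc.comap e, fun h => ht h.of_comap⟩
  · simp [hn]
  · simp [← hn, add_comm]

/-- Zhao, lower bound: a balanced bipartite graph on `2n`
vertices, `n = ms ≥ 64s²`, with the stated minimum degree, which cannot be
tiled with `K_{s,s}`. -/
theorem zhao_lower_bound (s m n : ℕ) (hs : 2 ≤ s) (hn : n = m * s)
    (hbig : 64 * s ^ 2 ≤ n) :
    ∃ (G : SimpleGraph (Fin (2 * n))) (A B : Finset (Fin (2 * n))),
      IsBipartition G A B ∧ A.card = n ∧ B.card = n ∧
      (Even m → MinDegreeIs G ((n : ℝ) / 2 + s - 2)) ∧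
      (Odd m → MinDegreeIs G (((n : ℝ) + 3 * s) / 2 - 3)) ∧
      ¬ KstTileable G s s := by
  obtain ⟨r, rfl⟩ := Nat.exists_eq_add_of_le' hs
  have hr : r ≤ r ^ 2 := Nat.le_self_pow two_ne_zero r
  rcases Nat.even_or_odd m with hm | hm
  · obtain ⟨k, rfl⟩ := hm
    set t := k * (r + 2) with ht
    have hnt : n = 2 * t := by rw [hn, ht]; ring
    have htr : 32 * (r + 2) ^ 2 ≤ t := by omega
    obtain ⟨u, hu⟩ : ∃ u, t = u + 1 := Nat.exists_eq_succ_of_ne_zero (by nlinarith)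
    have : NeZero u := ⟨by nlinarith⟩
    obtain ⟨D, hD⟩ : ∃ D : Finset (ZMod u), #D = r := by
      obtain ⟨D, hD, -⟩ := exists_sidon_zmod (q := u) (d := r) (by nlinarith)
      exact ⟨D, hD⟩
    obtain ⟨E, hE, hsidon⟩ := exists_sidon_zmod (q := u + 2) (d := r + 1) (by nlinarith)
    obtain ⟨G, A, B, h₁, h₂, h₃, h₄, h₅⟩ := exists_graph_of_blockGraph (D := D) (E := E)
      (n := n) (s := r + 2) (by simp only [ZMod.card]; omega)
      (minDegreeIs_blockGraph (by simp only [ZMod.card]; omega) rfl)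
      (not_kstTileable_blockGraph_of_card_lt (by omega) (by omega) hsidon
        (by simp only [ZMod.card]; omega))
    refine ⟨G, A, B, h₁, h₂, h₃, fun _ => ?_, fun h => ?_, h₅⟩
    · convert h₄ using 1
      rw [hnt, hu, ZMod.card, hE]
      push_cast
      ring
    · exact absurd ⟨k, rfl⟩ (Nat.not_even_iff_odd.2 h)
  · obtain ⟨k, rfl⟩ := hm
    set t := k * (r + 2) with ht
    have hnt : n = 2 * t + r + 2 := by rw [hn, ht]; ring
    have htr : 64 * (r + 2) ^ 2 ≤ 2 * t + r + 2 := by omega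
    obtain ⟨D, hD⟩ : ∃ D : Finset (ZMod (t + 1)), #D = r := by
      obtain ⟨D, hD, -⟩ := exists_sidon_zmod (q := t + 1) (d := r) (by nlinarith)
      exact ⟨D, hD⟩
    obtain ⟨E, hE, hsidon⟩ := exists_sidon_zmod (q := t + r + 1) (d := 2 * r) (by nlinarith)
    have hmod : (t + r + 1) % (r + 2) = r + 1 := by
      rw [ht, add_assoc, mul_comm, Nat.mul_add_mod, Nat.mod_eq_of_lt (by omega)]
    obtain ⟨G, A, B, h₁, h₂, h₃, h₄, h₅⟩ := exists_graph_of_blockGraph (D := D) (E := E)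
      (n := n) (s := r + 2) (by simp only [ZMod.card]; omega)
      (minDegreeIs_blockGraph (by simp only [ZMod.card]; omega) rfl)
      (not_kstTileable_blockGraph_of_lt_mod (by omega) hsidon
        (by simp only [ZMod.card]; omega))
    refine ⟨G, A, B, h₁, h₂, h₃, fun h => ?_, fun _ => ?_, h₅⟩
    · exact absurd h (Nat.not_even_iff_odd.2 ⟨k, rfl⟩)
    · convert h₄ using 1
      rw [hnt, ZMod.card, hE]
      push_cast
      ring

end PaperTiling
end
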